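/- The stabilizer {g ∈ SO(8) : g·cay = cay} of the Cayley form under the action of SO(8) on alternating 4-forms on ℝ⁸ is isomorphic as a group to Spin(7), the spin group of the standard quadratic form on ℝ⁷ (the group of unit even elements in the Clifford algebra of ℝ⁷ whose twisted conjugation preserves ℝ⁷). -/

import Mathlib

noncomputable section

open scoped BigOperators
open Matrix

/-- `ℝ⁸` with its standard Euclidean structure. -/
abbrev E8 : Type := EuclideanSpace ℝ (Fin 8)

/-- The standard orthonormal basis `e₁, …, e₈` of `ℝ⁸`. -/
def stdB : Fin 8 → E8 := fun i => EuclideanSpace.single i 1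

/-- The `j`-th coordinate functional `eʲ`. -/
def coordL (j : Fin 8) : E8 →ₗ[ℝ] ℝ :=
  (LinearMap.proj j).comp (WithLp.linearEquiv 2 ℝ (Fin 8 → ℝ)).toLinearMap

/-- Alternating 4-forms on `ℝ⁸`. -/
abbrev Form4 : Type := AlternatingMap ℝ E8 ℝ (Fin 4)

/-- The decomposable 4-form `eᵃ∧eᵇ∧eᶜ∧eᵈ` (value `det` of the coordinates). -/
def wedge4 (a b c d : Fin 8) : Form4 :=
  (Matrix.detRowAlternating : AlternatingMap ℝ (Fin 4 → ℝ) ℝ (Fin 4)).compLinearMap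
    (LinearMap.pi (fun i : Fin 4 => coordL (![a, b, c, d] i)))

/-- The comass `‖ω‖` of a 4-form: the sup of values on unit vectors. -/
def comass (ω : Form4) : ℝ :=
  sSup {r : ℝ | ∃ v : Fin 4 → E8, (∀ i, ‖v i‖ = 1) ∧ ω v = r}

open scoped Classical in
/-- The square `|ω|²` of the Euclidean norm of a 4-form:
the sum of the squares of the coefficients over increasing multi-indices. -/
def eNormSq (ω : Form4) : ℝ :=
  ∑ f ∈ Finset.univ.filter (fun f : Fin 4 → Fin 8 => StrictMono f),
    (ω (fun i => stdB (f i))) ^ 2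

/-- `e^{1234}` (1-indexed), i.e. `e¹∧e²∧e³∧e⁴` plus its Hodge dual. -/
def E1234 : Form4 := wedge4 0 1 2 3 + wedge4 4 5 6 7
def E1256 : Form4 := wedge4 0 1 4 5 + wedge4 2 3 6 7
def E1278 : Form4 := wedge4 0 1 6 7 + wedge4 2 3 4 5
def E1357 : Form4 := wedge4 0 2 4 6 + wedge4 1 3 5 7
def E1467 : Form4 := wedge4 0 3 5 6 + wedge4 1 2 4 7
def E1368 : Form4 := wedge4 0 2 5 7 + wedge4 1 3 4 6
def E1458 : Form4 := wedge4 0 3 4 7 + wedge4 1 2 5 6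

/-- The Cayley form. -/
def cay : Form4 := E1234 + E1256 + E1278 + E1357 - E1368 - E1458 - E1467

/-- A 4-form on `ℝ⁸` is self-dual if `ω(e_f) = ω(e_g)` whenever `f`, `g` are complementary
increasing multi-indices whose concatenation is an even permutation of `(1,…,8)`
(i.e. induces the standard orientation). -/
def SelfDual (ω : Form4) : Prop :=
  ∀ (f g : Fin 4 → Fin 8) (σ : Equiv.Perm (Fin 8)),
    StrictMono f → StrictMono g →
    (∀ i : Fin 8, σ i = Fin.append f g (Fin.cast (by norm_num) i)) →
    Equiv.Perm.sign σ = 1 →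
    ω (fun i => stdB (f i)) = ω (fun i => stdB (g i))

/-- Membership in `SO(8)`, as real `8 × 8` matrices. -/
def IsSO8 (g : Matrix (Fin 8) (Fin 8) ℝ) : Prop := g * gᵀ = 1 ∧ g.det = 1

/-- The linear action of an `8 × 8` matrix on `ℝ⁸`. -/
def mulVecL (g : Matrix (Fin 8) (Fin 8) ℝ) : E8 →ₗ[ℝ] E8 :=
  (WithLp.linearEquiv 2 ℝ (Fin 8 → ℝ)).symm.toLinearMap ∘ₗ
    g.mulVecLin ∘ₗ (WithLp.linearEquiv 2 ℝ (Fin 8 → ℝ)).toLinearMap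

/-- The action of a matrix `g` on 4-forms: `(g·ω)(v₁,…,v₄) = ω(g⁻¹v₁,…,g⁻¹v₄)`. -/
def formAct (g : Matrix (Fin 8) (Fin 8) ℝ) (ω : Form4) : Form4 :=
  ω.compLinearMap (mulVecL g⁻¹)

/-- Two 4-forms are `SO(8)`-conjugate if they lie in the same orbit. -/
def SOConj (ω η : Form4) : Prop := ∃ g, IsSO8 g ∧ formAct g ω = η

/-- The standard (positive definite) quadratic form `Σᵢ xᵢ²` on `ℝ⁷`. -/
def Q7 : QuadraticForm ℝ (Fin 7 → ℝ) :=
  QuadraticMap.weightedSumSquares ℝ (fun _ : Fin 7 => (1 : ℝ))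

/-- Seven anticommuting complex structures on `ℤ⁸`, with `Jint i e₁ = e_{i+2}`. They span the
seven-dimensional summand of the alternating 2-forms on `ℝ⁸` singled out by the Cayley form. -/
def Jint : Fin 7 → Matrix (Fin 8) (Fin 8) ℤ :=
  ![
    !![0, -1, 0, 0, 0, 0, 0, 0; 1, 0, 0, 0, 0, 0, 0, 0; 0, 0, 0, -1, 0, 0, 0, 0;
      0, 0, 1, 0, 0, 0, 0, 0; 0, 0, 0, 0, 0, -1, 0, 0; 0, 0, 0, 0, 1, 0, 0, 0;
      0, 0, 0, 0, 0, 0, 0, -1; 0, 0, 0, 0, 0, 0, 1, 0],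
    !![0, 0, -1, 0, 0, 0, 0, 0; 0, 0, 0, 1, 0, 0, 0, 0; 1, 0, 0, 0, 0, 0, 0, 0;
      0, -1, 0, 0, 0, 0, 0, 0; 0, 0, 0, 0, 0, 0, -1, 0; 0, 0, 0, 0, 0, 0, 0, 1;
      0, 0, 0, 0, 1, 0, 0, 0; 0, 0, 0, 0, 0, -1, 0, 0],
    !![0, 0, 0, -1, 0, 0, 0, 0; 0, 0, -1, 0, 0, 0, 0, 0; 0, 1, 0, 0, 0, 0, 0, 0;
      1, 0, 0, 0, 0, 0, 0, 0; 0, 0, 0, 0, 0, 0, 0, 1; 0, 0, 0, 0, 0, 0, 1, 0;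
      0, 0, 0, 0, 0, -1, 0, 0; 0, 0, 0, 0, -1, 0, 0, 0],
    !![0, 0, 0, 0, -1, 0, 0, 0; 0, 0, 0, 0, 0, 1, 0, 0; 0, 0, 0, 0, 0, 0, 1, 0;
      0, 0, 0, 0, 0, 0, 0, -1; 1, 0, 0, 0, 0, 0, 0, 0; 0, -1, 0, 0, 0, 0, 0, 0;
      0, 0, -1, 0, 0, 0, 0, 0; 0, 0, 0, 1, 0, 0, 0, 0],
    !![0, 0, 0, 0, 0, -1, 0, 0; 0, 0, 0, 0, -1, 0, 0, 0; 0, 0, 0, 0, 0, 0, 0, -1;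
      0, 0, 0, 0, 0, 0, -1, 0; 0, 1, 0, 0, 0, 0, 0, 0; 1, 0, 0, 0, 0, 0, 0, 0;
      0, 0, 0, 1, 0, 0, 0, 0; 0, 0, 1, 0, 0, 0, 0, 0],
    !![0, 0, 0, 0, 0, 0, -1, 0; 0, 0, 0, 0, 0, 0, 0, 1; 0, 0, 0, 0, -1, 0, 0, 0;
      0, 0, 0, 0, 0, 1, 0, 0; 0, 0, 1, 0, 0, 0, 0, 0; 0, 0, 0, -1, 0, 0, 0, 0;
      1, 0, 0, 0, 0, 0, 0, 0; 0, -1, 0, 0, 0, 0, 0, 0],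
    !![0, 0, 0, 0, 0, 0, 0, -1; 0, 0, 0, 0, 0, 0, -1, 0; 0, 0, 0, 0, 0, 1, 0, 0;
      0, 0, 0, 0, 1, 0, 0, 0; 0, 0, 0, -1, 0, 0, 0, 0; 0, 0, -1, 0, 0, 0, 0, 0;
      0, 1, 0, 0, 0, 0, 0, 0; 1, 0, 0, 0, 0, 0, 0, 0]]

theorem Jint_mul_add_mul (i j : Fin 7) :
    Jint i * Jint j + Jint j * Jint i = if i = j then -2 else 0 := by
  revert i j
  decide +kernel

theorem Jint_transpose (i : Fin 7) : (Jint i)ᵀ = -Jint i := by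
  revert i
  decide +kernel

theorem Jint_trace_transpose_mul (i j : Fin 7) :
    ((Jint i)ᵀ * Jint j).trace = if i = j then 8 else 0 := by
  revert i j
  decide +kernel

theorem Jint_prod : (List.ofFn Jint).prod = 1 := by
  decide +kernel

/-- The `a`-th matrix sends the first basis vector to the `a`-th basis vector. -/
def Kint : Fin 8 → Matrix (Fin 8) (Fin 8) ℤ := Fin.cons 1 Jint

theorem Kint_mul_idempotent_mul (a b : Fin 8) :
    Kint a * ((1 - Jint 0 * Jint 1 * Jint 2) * (1 - Jint 0 * Jint 3 * Jint 4) *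
      (1 - Jint 1 * Jint 3 * Jint 5)) * (Kint b)ᵀ = Matrix.single a b 8 := by
  revert a b
  decide +kernel

/-- The complex structures `Jint` as real matrices. -/
def Jreal (i : Fin 7) : Matrix (Fin 8) (Fin 8) ℝ := (Int.castRingHom ℝ).mapMatrix (Jint i)

theorem Jreal_mul_add_mul (i j : Fin 7) :
    Jreal i * Jreal j + Jreal j * Jreal i = if i = j then -2 else 0 := by
  simp only [Jreal, ← map_mul, ← map_add, Jint_mul_add_mul]
  split_ifs with h
  · rw [map_neg, map_ofNat]
  · rw [map_zero]

theorem Jreal_transpose (i : Fin 7) : (Jreal i)ᵀ = -Jreal i := by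
  have h := congrArg (Int.castRingHom ℝ).mapMatrix (Jint_transpose i)
  rwa [map_neg] at h

theorem Jreal_trace_transpose_mul (i j : Fin 7) :
    ((Jreal i)ᵀ * Jreal j).trace = if i = j then 8 else 0 := by
  have h := congrArg (Int.castRingHom ℝ) (Jint_trace_transpose_mul i j)
  rw [AddMonoidHom.map_trace, ← RingHom.mapMatrix_apply, map_mul, apply_ite (Int.castRingHom ℝ),
    map_ofNat, map_zero] at h
  exact h

theorem Jreal_prod : (List.ofFn Jreal).prod = 1 := by
  have h := congrArg (Int.castRingHom ℝ).mapMatrix Jint_prod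
  rwa [map_list_prod, List.map_ofFn, map_one] at h

/-- The algebra generated by the complex structures is the full matrix algebra. -/
theorem adjoin_range_Jreal : Algebra.adjoin ℝ (Set.range Jreal) = ⊤ := by
  set S := Algebra.adjoin ℝ (Set.range Jreal)
  have hJ (i : Fin 7) : Jreal i ∈ S := Algebra.subset_adjoin ⟨i, rfl⟩
  have hK (a : Fin 8) : (Int.castRingHom ℝ).mapMatrix (Kint a) ∈ S ∧
      (Int.castRingHom ℝ).mapMatrix (Kint a)ᵀ ∈ S := by
    induction a using Fin.cases with
    | zero => simp [Kint, S.one_mem]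
    | succ i =>
      simp only [Kint, Fin.cons_succ, Jint_transpose, map_neg]
      exact ⟨hJ i, S.neg_mem (hJ i)⟩
  have hsingle (a b : Fin 8) (r : ℝ) : Matrix.single a b r ∈ S := by
    have h := congrArg (Int.castRingHom ℝ).mapMatrix (Kint_mul_idempotent_mul a b)
    simp only [map_mul, map_sub, map_one] at h
    have h8 : Matrix.single a b r =
        (r / 8) • (Int.castRingHom ℝ).mapMatrix (Matrix.single a b 8) := by
      rw [RingHom.mapMatrix_apply, Matrix.map_single, Matrix.smul_single]
      simp
    rw [h8, ← h]
    refine S.smul_mem (S.mul_mem (S.mul_mem (hK a).1 (S.mul_mem (S.mul_mem ?_ ?_) ?_)) (hK b).2) _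
    all_goals exact S.sub_mem S.one_mem (S.mul_mem (S.mul_mem (hJ _) (hJ _)) (hJ _))
  rw [eq_top_iff]
  intro A _
  rw [Matrix.matrix_eq_sum_single A]
  exact S.sum_mem fun i _ => S.sum_mem fun j _ => hsingle i j _

/-- A real matrix commuting with all the complex structures is scalar. -/
theorem exists_eq_smul_one_of_commute_Jreal {A : Matrix (Fin 8) (Fin 8) ℝ}
    (h : ∀ i, Jreal i * A = A * Jreal i) : ∃ c : ℝ, A = c • 1 := by
  have hle : Algebra.adjoin ℝ (Set.range Jreal) ≤ Subalgebra.centralizer ℝ {A} := by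
    rw [Algebra.adjoin_le_iff]
    rintro _ ⟨i, rfl⟩
    rw [SetLike.mem_coe, Subalgebra.mem_centralizer_iff]
    rintro _ rfl
    exact (h i).symm
  have hA : A ∈ Set.center (Matrix (Fin 8) (Fin 8) ℝ) := by
    rw [Semigroup.mem_center_iff]
    intro B
    have hB := hle (adjoin_range_Jreal ▸ Algebra.mem_top : B ∈ _)
    exact ((Subalgebra.mem_centralizer_iff ℝ).1 hB A rfl).symm
  rw [Matrix.center_eq_range] at hA
  obtain ⟨c, rfl⟩ := hA
  exact ⟨c, by simp [Matrix.smul_one_eq_diagonal]⟩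

theorem finite_exteriorAlgebra_and_finrank_le (V : Type*) [AddCommGroup V] [Module ℝ V]
    [Module.Finite ℝ V] :
    Module.Finite ℝ (ExteriorAlgebra ℝ V) ∧
      Module.finrank ℝ (ExteriorAlgebra ℝ V) ≤ 2 ^ Module.finrank ℝ V := by
  set n := Module.finrank ℝ V
  let f : (∀ i : Fin (n + 1), ⋀[ℝ]^(i : ℕ) V) →ₗ[ℝ] ExteriorAlgebra ℝ V :=
    LinearMap.lsum ℝ _ ℝ fun i => (⋀[ℝ]^(i : ℕ) V).subtype
  have hf : Function.Surjective f := by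
    rw [← LinearMap.range_eq_top, eq_top_iff,
      ← (DirectSum.Decomposition.isInternal fun i : ℕ => ⋀[ℝ]^i V).submodule_iSup_eq_top]
    refine iSup_le fun i x hx => ?_
    rcases lt_or_ge i (n + 1) with hi | hi
    · exact ⟨Pi.single ⟨i, hi⟩ ⟨x, hx⟩, by
        simp only [f, LinearMap.lsum_piSingle, Submodule.subtype_apply]⟩
    · have h0 : Module.finrank ℝ (⋀[ℝ]^i V) = 0 := by
        rw [exteriorPower.finrank_eq, Nat.choose_eq_zero_of_lt hi]
      rw [Submodule.finrank_eq_zero] at h0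
      rw [h0, Submodule.mem_bot] at hx
      exact hx ▸ zero_mem _
  refine ⟨Module.Finite.of_surjective f hf,
    (LinearMap.finrank_le_finrank_of_surjective hf).trans ?_⟩
  rw [Module.finrank_pi_fintype]
  simp only [exteriorPower.finrank_eq]
  rw [Fin.sum_univ_eq_sum_range (fun i => n.choose i), Nat.sum_range_choose]

theorem finite_cliffordAlgebra_and_finrank_le {V : Type*} [AddCommGroup V] [Module ℝ V]
    [Module.Finite ℝ V] (Q : QuadraticForm ℝ V) :
    Module.Finite ℝ (CliffordAlgebra Q) ∧
      Module.finrank ℝ (CliffordAlgebra Q) ≤ 2 ^ Module.finrank ℝ V := by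
  obtain ⟨hfin, hle⟩ := finite_exteriorAlgebra_and_finrank_le V
  exact ⟨Module.Finite.equiv (CliffordAlgebra.equivExterior Q).symm,
    (CliffordAlgebra.equivExterior Q).finrank_eq ▸ hle⟩

/-- The values on `a, b` of the seven 2-forms `ωᵢ a b = a ⬝ᵥ (Jᵢ *ᵥ b)`. -/
def omegaVec (a b : Fin 8 → ℝ) : Fin 7 → ℝ := fun i => a ⬝ᵥ (Jreal i *ᵥ b)

/-- The alternation of `∑ i, ωᵢ ⊗ ωᵢ`, where `ωᵢ a b = a ⬝ᵥ (Jᵢ *ᵥ b)`. -/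
def altSum (a b c d : Fin 8 → ℝ) : ℝ :=
  omegaVec a b ⬝ᵥ omegaVec c d - omegaVec a c ⬝ᵥ omegaVec b d + omegaVec a d ⬝ᵥ omegaVec b c

theorem det_fin_four (A : Matrix (Fin 4) (Fin 4) ℝ) :
    A.det =
      (A 0 0 * A 1 1 - A 0 1 * A 1 0) * (A 2 2 * A 3 3 - A 2 3 * A 3 2) -
      (A 0 0 * A 1 2 - A 0 2 * A 1 0) * (A 2 1 * A 3 3 - A 2 3 * A 3 1) +
      (A 0 0 * A 1 3 - A 0 3 * A 1 0) * (A 2 1 * A 3 2 - A 2 2 * A 3 1) +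
      (A 0 1 * A 1 2 - A 0 2 * A 1 1) * (A 2 0 * A 3 3 - A 2 3 * A 3 0) -
      (A 0 1 * A 1 3 - A 0 3 * A 1 1) * (A 2 0 * A 3 2 - A 2 2 * A 3 0) +
      (A 0 2 * A 1 3 - A 0 3 * A 1 2) * (A 2 0 * A 3 1 - A 2 1 * A 3 0) := by
  simp only [Matrix.det_succ_row_zero, Fin.sum_univ_succ, Matrix.submatrix_apply, Fin.succAbove,
    Fin.isValue, Matrix.det_unique, Fin.default_eq_zero, Finset.univ_unique, Finset.sum_singleton]
  simp [Fin.lt_def, Fin.succ]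
  ring

theorem wedge4_apply (a b c d : Fin 8) (v : Fin 4 → E8) :
    wedge4 a b c d v = (Matrix.of fun i j => v i (![a, b, c, d] j)).det := rfl

theorem omegaVec_eq (x y : Fin 8 → ℝ) :
    omegaVec x y = ![
      -x 0 * y 1 + x 1 * y 0 - x 2 * y 3 + x 3 * y 2 - x 4 * y 5 + x 5 * y 4 - x 6 * y 7
        + x 7 * y 6,
      -x 0 * y 2 + x 1 * y 3 + x 2 * y 0 - x 3 * y 1 - x 4 * y 6 + x 5 * y 7 + x 6 * y 4
        - x 7 * y 5,
      -x 0 * y 3 - x 1 * y 2 + x 2 * y 1 + x 3 * y 0 + x 4 * y 7 + x 5 * y 6 - x 6 * y 5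
        - x 7 * y 4,
      -x 0 * y 4 + x 1 * y 5 + x 2 * y 6 - x 3 * y 7 + x 4 * y 0 - x 5 * y 1 - x 6 * y 2
        + x 7 * y 3,
      -x 0 * y 5 - x 1 * y 4 - x 2 * y 7 - x 3 * y 6 + x 4 * y 1 + x 5 * y 0 + x 6 * y 3
        + x 7 * y 2,
      -x 0 * y 6 + x 1 * y 7 - x 2 * y 4 + x 3 * y 5 + x 4 * y 2 - x 5 * y 3 + x 6 * y 0
        - x 7 * y 1,
      -x 0 * y 7 - x 1 * y 6 + x 2 * y 5 + x 3 * y 4 - x 4 * y 3 - x 5 * y 2 + x 6 * y 1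
        + x 7 * y 0] := by
  ext i
  fin_cases i <;>
  · simp [omegaVec, Jreal, Jint, dotProduct, Matrix.mulVec, Fin.sum_univ_eight]
    ring

theorem three_mul_cay_apply (v : Fin 4 → E8) :
    3 * cay v = altSum (v 0).ofLp (v 1).ofLp (v 2).ofLp (v 3).ofLp := by
  simp only [altSum, omegaVec_eq, dotProduct, Fin.sum_univ_seven, cay, E1234, E1256, E1278,
    E1357, E1467, E1368, E1458,
    AlternatingMap.add_apply, AlternatingMap.sub_apply, wedge4_apply, det_fin_four,
    Matrix.of_apply, Matrix.cons_val]
  ring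

/-- The linear embedding of `ℝ⁷` into skew matrices whose values square to scalars. -/
def gam : (Fin 7 → ℝ) →ₗ[ℝ] Matrix (Fin 8) (Fin 8) ℝ := Fintype.linearCombination ℝ Jreal

theorem gam_apply (v : Fin 7 → ℝ) : gam v = ∑ i, v i • Jreal i := rfl

theorem gam_single (i : Fin 7) : gam (Pi.single i 1) = Jreal i := by
  rw [gam, Fintype.linearCombination_apply_single, one_smul]

theorem gam_transpose (v : Fin 7 → ℝ) : (gam v)ᵀ = -gam v := by
  simp [gam_apply, Matrix.transpose_sum, Jreal_transpose]

theorem gam_mul_add_mul (v w : Fin 7 → ℝ) :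
    gam v * gam w + gam w * gam v = (-2 * (v ⬝ᵥ w)) • 1 := by
  have h : gam v * gam w + gam w * gam v =
      ∑ i, ∑ j, (v i * w j) • (Jreal i * Jreal j + Jreal j * Jreal i) := by
    simp only [gam_apply, Finset.sum_mul_sum, smul_mul_smul_comm, smul_add,
      Finset.sum_add_distrib]
    rw [Finset.sum_comm (f := fun i j => (w i * v j) • (Jreal i * Jreal j))]
    simp only [mul_comm]
  have h2 : (-2 : Matrix (Fin 8) (Fin 8) ℝ) = (-2 : ℝ) • 1 := by
    rw [neg_smul, ofNat_smul_eq_nsmul, nsmul_one, Nat.cast_ofNat]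
  simp only [h, Jreal_mul_add_mul, smul_ite, smul_zero, Finset.sum_ite_eq, Finset.mem_univ,
    if_true, h2, smul_smul, ← Finset.sum_smul, dotProduct, Finset.mul_sum]
  congr 1
  exact Finset.sum_congr rfl fun i _ => by ring

theorem gam_mul_self (v : Fin 7 → ℝ) : gam v * gam v = (-(v ⬝ᵥ v)) • 1 := by
  have h := gam_mul_add_mul v v
  rw [← two_smul ℝ, neg_mul, ← mul_neg, mul_smul] at h
  exact smul_right_injective _ (two_ne_zero (α := ℝ)) h

theorem Q7_apply (v : Fin 7 → ℝ) : Q7 v = v ⬝ᵥ v := by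
  simp [Q7, QuadraticMap.weightedSumSquares_apply, dotProduct]

theorem Jreal_mul_self (i : Fin 7) : Jreal i * Jreal i = -1 := by
  simpa [gam_single] using gam_mul_self (Pi.single i 1)

/-- A matrix normalizing the image of `gam` acts there by an orthogonal matrix. -/
theorem transpose_mul_self_of_conj_gam {g : Matrix (Fin 8) (Fin 8) ℝ}
    {R : Matrix (Fin 7) (Fin 7) ℝ} (hg : g * gᵀ = 1)
    (h : ∀ v, g * gam v * gᵀ = gam (R *ᵥ v)) : Rᵀ * R = 1 := by
  have hg' : gᵀ * g = 1 := mul_eq_one_comm.1 hg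
  have key (v w : Fin 7 → ℝ) : (R *ᵥ v) ⬝ᵥ (R *ᵥ w) = v ⬝ᵥ w := by
    have hmul (v w : Fin 7 → ℝ) : gam (R *ᵥ v) * gam (R *ᵥ w) = g * (gam v * gam w) * gᵀ := by
      rw [← h, ← h]
      calc g * gam v * gᵀ * (g * gam w * gᵀ) = g * gam v * (gᵀ * g) * gam w * gᵀ := by
            simp only [mul_assoc]
        _ = g * (gam v * gam w) * gᵀ := by rw [hg']; simp only [mul_assoc, one_mul]
    have h1 := gam_mul_add_mul (R *ᵥ v) (R *ᵥ w)
    rw [hmul, hmul, ← add_mul, ← mul_add, gam_mul_add_mul, mul_smul_comm, mul_one,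
      smul_mul_assoc, hg] at h1
    have h2 := smul_left_injective ℝ (one_ne_zero (α := Matrix (Fin 8) (Fin 8) ℝ)) h1
    linarith
  ext i j
  have hij := key (Pi.single i 1) (Pi.single j 1)
  simpa [Matrix.mulVec_single_one, Matrix.mul_apply, dotProduct, Matrix.one_apply, Matrix.col,
    Pi.single_apply, eq_comm] using hij

theorem omegaVec_transpose_mulVec {g : Matrix (Fin 8) (Fin 8) ℝ}
    {R : Matrix (Fin 7) (Fin 7) ℝ} (h : ∀ v, g * gam v * gᵀ = gam (R *ᵥ v))
    (a b : Fin 8 → ℝ) : omegaVec (gᵀ *ᵥ a) (gᵀ *ᵥ b) = Rᵀ *ᵥ omegaVec a b := by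
  ext i
  have hi := h (Pi.single i 1)
  rw [gam_single, Matrix.mulVec_single_one, gam_apply] at hi
  calc (gᵀ *ᵥ a) ⬝ᵥ (Jreal i *ᵥ (gᵀ *ᵥ b)) = a ⬝ᵥ ((g * Jreal i * gᵀ) *ᵥ b) := by
        rw [Matrix.mulVec_transpose, ← Matrix.dotProduct_mulVec, Matrix.mulVec_mulVec,
          Matrix.mulVec_mulVec, mul_assoc]
    _ = ∑ j, R j i * (a ⬝ᵥ (Jreal j *ᵥ b)) := by
        simp [hi, Matrix.sum_mulVec, dotProduct_sum, Matrix.smul_mulVec, Matrix.col]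

theorem altSum_transpose_mulVec {g : Matrix (Fin 8) (Fin 8) ℝ}
    {R : Matrix (Fin 7) (Fin 7) ℝ} (hg : g * gᵀ = 1)
    (h : ∀ v, g * gam v * gᵀ = gam (R *ᵥ v)) (a b c d : Fin 8 → ℝ) :
    altSum (gᵀ *ᵥ a) (gᵀ *ᵥ b) (gᵀ *ᵥ c) (gᵀ *ᵥ d) = altSum a b c d := by
  have hR : R * Rᵀ = 1 := mul_eq_one_comm.1 (transpose_mul_self_of_conj_gam hg h)
  have hdot (u w : Fin 7 → ℝ) : (Rᵀ *ᵥ u) ⬝ᵥ (Rᵀ *ᵥ w) = u ⬝ᵥ w := by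
    rw [Matrix.mulVec_transpose, ← Matrix.dotProduct_mulVec, Matrix.mulVec_mulVec, hR,
      Matrix.one_mulVec]
  simp only [altSum, omegaVec_transpose_mulVec h, hdot]

/-- The matrix of the bilinear form `a b ↦ altSum a b c d`. -/
def altMat (c d : Fin 8 → ℝ) : Matrix (Fin 8) (Fin 8) ℝ :=
  ∑ i, (omegaVec c d i • Jreal i -
    Matrix.vecMulVec (Jreal i *ᵥ c) (Jreal i *ᵥ d) +
    Matrix.vecMulVec (Jreal i *ᵥ d) (Jreal i *ᵥ c))

theorem dotProduct_vecMulVec_mulVec {n : Type*} [Fintype n] (a b x y : n → ℝ) :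
    a ⬝ᵥ (Matrix.vecMulVec x y *ᵥ b) = (a ⬝ᵥ x) * (b ⬝ᵥ y) := by
  rw [Matrix.vecMulVec_mulVec, op_smul_eq_smul, dotProduct_smul, smul_eq_mul, mul_comm,
    dotProduct_comm y]

theorem dotProduct_altMat_mulVec (a b c d : Fin 8 → ℝ) :
    a ⬝ᵥ (altMat c d *ᵥ b) = altSum a b c d := by
  simp only [altMat, Matrix.sum_mulVec, dotProduct_sum, Matrix.add_mulVec, Matrix.sub_mulVec,
    dotProduct_add, dotProduct_sub, Matrix.smul_mulVec, dotProduct_smul, smul_eq_mul,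
    dotProduct_vecMulVec_mulVec, Finset.sum_add_distrib, Finset.sum_sub_distrib, altSum]
  congr 2
  exact Finset.sum_congr rfl fun i _ => mul_comm _ _

/-- The contraction of `altSum` with a skew matrix. -/
def contr (A : Matrix (Fin 8) (Fin 8) ℝ) : Matrix (Fin 8) (Fin 8) ℝ :=
  ∑ i, (((Jreal i)ᵀ * A).trace • Jreal i + (2 : ℝ) • (Jreal i * A * Jreal i))

theorem trace_vecMulVec_transpose_mul {n : Type*} [Fintype n] (x y : n → ℝ) (A : Matrix n n ℝ) :
    ((Matrix.vecMulVec x y)ᵀ * A).trace = x ⬝ᵥ (A *ᵥ y) := by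
  rw [Matrix.transpose_vecMulVec, Matrix.vecMulVec_mul, Matrix.trace_vecMulVec, dotProduct_comm,
    Matrix.dotProduct_mulVec]

theorem trace_altMat_transpose_mul {A : Matrix (Fin 8) (Fin 8) ℝ} (hA : Aᵀ = -A)
    (c d : Fin 8 → ℝ) : ((altMat c d)ᵀ * A).trace = c ⬝ᵥ (contr A *ᵥ d) := by
  have h1 (i : Fin 7) : (Jreal i *ᵥ c) ⬝ᵥ (A *ᵥ (Jreal i *ᵥ d)) =
      -(c ⬝ᵥ ((Jreal i * A * Jreal i) *ᵥ d)) := by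
    rw [← Matrix.vecMul_transpose, Jreal_transpose, ← Matrix.dotProduct_mulVec,
      Matrix.neg_mulVec, dotProduct_neg, Matrix.mulVec_mulVec, Matrix.mulVec_mulVec, mul_assoc]
  have h2 (i : Fin 7) : (Jreal i *ᵥ d) ⬝ᵥ (A *ᵥ (Jreal i *ᵥ c)) =
      c ⬝ᵥ ((Jreal i * A * Jreal i) *ᵥ d) := by
    rw [Matrix.dotProduct_mulVec, ← Matrix.mulVec_transpose, hA, Matrix.neg_mulVec,
      neg_dotProduct, dotProduct_comm, h1, neg_neg]
  simp only [altMat, contr, Matrix.transpose_sum, Finset.sum_mul, Matrix.trace_sum,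
    Matrix.sum_mulVec, dotProduct_sum, Matrix.transpose_add, Matrix.transpose_sub,
    Matrix.transpose_smul, add_mul, sub_mul, Matrix.trace_add, Matrix.trace_sub,
    smul_mul_assoc, Matrix.trace_smul, trace_vecMulVec_transpose_mul, h1, h2,
    Matrix.add_mulVec, Matrix.smul_mulVec, dotProduct_add, dotProduct_smul, smul_eq_mul]
  exact Finset.sum_congr rfl fun i _ => by rw [omegaVec]; ring

theorem Jreal_mul_mul_Jreal (i k : Fin 7) :
    Jreal i * Jreal k * Jreal i = Jreal k - if i = k then (2 : ℝ) • Jreal k else 0 := by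
  rw [eq_sub_of_add_eq (Jreal_mul_add_mul i k), sub_mul, mul_assoc, Jreal_mul_self]
  split_ifs with h
  · rw [h, two_smul]
    noncomm_ring
  · noncomm_ring

theorem contr_Jreal (k : Fin 7) : contr (Jreal k) = (18 : ℝ) • Jreal k := by
  simp only [contr, Jreal_trace_transpose_mul, Jreal_mul_mul_Jreal, Finset.sum_add_distrib,
    ← Finset.smul_sum, Finset.sum_sub_distrib, ite_smul, zero_smul, Finset.sum_ite_eq',
    Finset.mem_univ, if_true, Finset.sum_const, Finset.card_univ, Fintype.card_fin]
  module

theorem trace_transpose_mul_self_nonneg {n : Type*} [Fintype n] (A : Matrix n n ℝ) :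
    0 ≤ (Aᵀ * A).trace := by
  rw [Matrix.trace]
  exact Finset.sum_nonneg fun i _ => Finset.sum_nonneg fun j _ => mul_self_nonneg _

/-- `A ↦ Jᵢ A Jᵢ` is a Frobenius isometry, so `A` has inner product at most `|A|²` with its
image. -/
theorem trace_transpose_mul_conj_le (A : Matrix (Fin 8) (Fin 8) ℝ) (i : Fin 7) :
    (Aᵀ * (Jreal i * A * Jreal i)).trace ≤ (Aᵀ * A).trace := by
  have h := trace_transpose_mul_self_nonneg (A - Jreal i * A * Jreal i)
  have h1 : ((Jreal i * A * Jreal i)ᵀ * A).trace = (Aᵀ * (Jreal i * A * Jreal i)).trace := by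
    rw [← Matrix.trace_transpose, Matrix.transpose_mul, Matrix.transpose_transpose]
  have h2 : ((Jreal i * A * Jreal i)ᵀ * (Jreal i * A * Jreal i)).trace = (Aᵀ * A).trace := by
    simp only [Matrix.transpose_mul, Jreal_transpose]
    calc (-Jreal i * (Aᵀ * -Jreal i) * (Jreal i * A * Jreal i)).trace
        = (Jreal i * Aᵀ * (Jreal i * Jreal i) * A * Jreal i).trace := by
          congr 1; noncomm_ring
      _ = (Jreal i * (Jreal i * Aᵀ * (Jreal i * Jreal i) * A)).trace := by
          rw [Matrix.trace_mul_comm]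
      _ = ((Jreal i * Jreal i) * Aᵀ * (Jreal i * Jreal i) * A).trace := by
          simp only [mul_assoc]
      _ = (Aᵀ * A).trace := by rw [Jreal_mul_self]; congr 1; noncomm_ring
  rw [Matrix.transpose_sub, sub_mul, mul_sub, mul_sub, Matrix.trace_sub, Matrix.trace_sub,
    Matrix.trace_sub, h1, h2] at h
  linarith

/-- The eigenspace of `contr` for the eigenvalue `18` is the image of `gam`. -/
theorem eq_gam_of_contr_eq {A : Matrix (Fin 8) (Fin 8) ℝ} (h : contr A = (18 : ℝ) • A) :
    A = gam fun i => ((Jreal i)ᵀ * A).trace / 8 := by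
  set u : Fin 7 → ℝ := fun i => ((Jreal i)ᵀ * A).trace / 8
  set B := A - gam u with hB
  have hcontr : contr A = (8 : ℝ) • gam u + (2 : ℝ) • ∑ i, Jreal i * A * Jreal i := by
    simp only [contr, gam_apply, Finset.sum_add_distrib, Finset.smul_sum, smul_smul, u]
    congr 1
    exact Finset.sum_congr rfl fun i _ => by rw [mul_div_cancel₀ _ (by norm_num : (8 : ℝ) ≠ 0)]
  have hgam : ∑ i, Jreal i * gam u * Jreal i = (5 : ℝ) • gam u := by
    simp only [gam_apply, Finset.mul_sum, Finset.sum_mul, mul_smul_comm, smul_mul_assoc,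
      Jreal_mul_mul_Jreal]
    rw [Finset.sum_comm, Finset.smul_sum]
    refine Finset.sum_congr rfl fun k _ => ?_
    rw [← Finset.smul_sum, Finset.sum_sub_distrib, Finset.sum_ite_eq', if_pos (Finset.mem_univ _),
      Finset.sum_const, Finset.card_univ, Fintype.card_fin]
    module
  have hsum : ∑ i, Jreal i * B * Jreal i = (9 : ℝ) • B := by
    have h9 : ∑ i, Jreal i * A * Jreal i = (9 : ℝ) • A - (4 : ℝ) • gam u := by
      refine smul_right_injective _ (two_ne_zero (α := ℝ)) ?_
      simp only
      rw [← sub_eq_of_eq_add' hcontr, h]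
      module
    simp only [hB, mul_sub, sub_mul, Finset.sum_sub_distrib, h9, hgam]
    module
  have hle : 9 * (Bᵀ * B).trace ≤ 7 * (Bᵀ * B).trace := by
    calc 9 * (Bᵀ * B).trace = ∑ i, (Bᵀ * (Jreal i * B * Jreal i)).trace := by
          rw [← Matrix.trace_sum, ← Finset.mul_sum, hsum, mul_smul_comm, Matrix.trace_smul,
            smul_eq_mul]
      _ ≤ ∑ _i : Fin 7, (Bᵀ * B).trace :=
          Finset.sum_le_sum fun i _ => trace_transpose_mul_conj_le B i
      _ = 7 * (Bᵀ * B).trace := by simp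
  have h0 : (Bᴴ * B).trace = 0 := by
    rw [Matrix.conjTranspose_eq_transpose_of_trivial]
    linarith [trace_transpose_mul_self_nonneg B]
  exact sub_eq_zero.1 (Matrix.trace_conjTranspose_mul_self_eq_zero_iff.1 h0)

theorem exists_conj_gam_of_forall_Jreal {g : Matrix (Fin 8) (Fin 8) ℝ}
    (h : ∀ k, ∃ w, g * Jreal k * gᵀ = gam w) :
    ∃ R : Matrix (Fin 7) (Fin 7) ℝ, ∀ v, g * gam v * gᵀ = gam (R *ᵥ v) := by
  choose w hw using h
  have hlin : (LinearMap.mulRight ℝ gᵀ ∘ₗ LinearMap.mulLeft ℝ g) ∘ₗ gam =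
      gam ∘ₗ (Matrix.of w)ᵀ.mulVecLin := by
    refine LinearMap.pi_ext' fun k => LinearMap.ext_ring ?_
    simp only [LinearMap.comp_apply, LinearMap.single_apply, LinearMap.mulRight_apply,
      LinearMap.mulLeft_apply, gam_single, Matrix.mulVecLin_apply, Matrix.mulVec_single_one]
    exact hw k
  exact ⟨(Matrix.of w)ᵀ, LinearMap.congr_fun hlin⟩

/-- An orthogonal matrix preserving `altSum` normalizes the image of `gam`. -/
theorem exists_conj_gam_of_altSum {g : Matrix (Fin 8) (Fin 8) ℝ} (hg : g * gᵀ = 1)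
    (h : ∀ a b c d, altSum (gᵀ *ᵥ a) (gᵀ *ᵥ b) (gᵀ *ᵥ c) (gᵀ *ᵥ d) = altSum a b c d) :
    ∃ R : Matrix (Fin 7) (Fin 7) ℝ, ∀ v, g * gam v * gᵀ = gam (R *ᵥ v) := by
  have hg' : gᵀ * g = 1 := mul_eq_one_comm.1 hg
  have hmat (c d : Fin 8 → ℝ) :
      gᵀ * altMat c d * g = altMat (gᵀ *ᵥ c) (gᵀ *ᵥ d) := by
    refine Matrix.ext_of_mulVec_single fun j => ?_
    refine dotProduct_eq _ _ fun a => ?_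
    rw [dotProduct_comm, dotProduct_comm _ a, dotProduct_altMat_mulVec]
    have hab := h (g *ᵥ a) (g *ᵥ Pi.single j 1) c d
    rw [Matrix.mulVec_mulVec, Matrix.mulVec_mulVec, hg', Matrix.one_mulVec,
      Matrix.one_mulVec] at hab
    rw [hab, ← dotProduct_altMat_mulVec, ← Matrix.mulVec_mulVec, ← Matrix.mulVec_mulVec,
      Matrix.dotProduct_mulVec a, Matrix.vecMul_transpose]
  have hskew (k : Fin 7) : (g * Jreal k * gᵀ)ᵀ = -(g * Jreal k * gᵀ) := by
    simp [Matrix.transpose_mul, Jreal_transpose, mul_assoc]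
  have hcontr (k : Fin 7) : contr (g * Jreal k * gᵀ) = (18 : ℝ) • (g * Jreal k * gᵀ) := by
    refine Matrix.ext_of_mulVec_single fun j => ?_
    refine dotProduct_eq _ _ fun c => ?_
    rw [dotProduct_comm, dotProduct_comm _ c, ← trace_altMat_transpose_mul (hskew k)]
    calc ((altMat c (Pi.single j 1))ᵀ * (g * Jreal k * gᵀ)).trace
        = ((gᵀ * altMat c (Pi.single j 1) * g)ᵀ * Jreal k).trace := by
          rw [← mul_assoc, Matrix.trace_mul_comm]
          simp only [Matrix.transpose_mul, Matrix.transpose_transpose, mul_assoc]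
      _ = c ⬝ᵥ (((18 : ℝ) • (g * Jreal k * gᵀ)) *ᵥ Pi.single j 1) := by
          rw [hmat, trace_altMat_transpose_mul (Jreal_transpose k), contr_Jreal,
            Matrix.smul_mulVec, Matrix.smul_mulVec, dotProduct_smul, dotProduct_smul,
            Matrix.mulVec_transpose g c, ← Matrix.dotProduct_mulVec, Matrix.mulVec_mulVec,
            Matrix.mulVec_mulVec, mul_assoc]
  exact exists_conj_gam_of_forall_Jreal fun k => ⟨_, eq_gam_of_contr_eq (hcontr k)⟩

theorem formAct_cay_eq_iff {g : Matrix (Fin 8) (Fin 8) ℝ} (hg : g * gᵀ = 1) :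
    formAct g cay = cay ↔
      ∃ R : Matrix (Fin 7) (Fin 7) ℝ, ∀ v, g * gam v * gᵀ = gam (R *ᵥ v) := by
  have hinv : g⁻¹ = gᵀ := Matrix.inv_eq_right_inv hg
  have hact (v : Fin 4 → E8) : 3 * formAct g cay v = altSum (gᵀ *ᵥ (v 0).ofLp)
      (gᵀ *ᵥ (v 1).ofLp) (gᵀ *ᵥ (v 2).ofLp) (gᵀ *ᵥ (v 3).ofLp) := by
    rw [formAct, AlternatingMap.compLinearMap_apply, three_mul_cay_apply, hinv]
    rfl
  constructor
  · refine fun h => exists_conj_gam_of_altSum hg fun a b c d => ?_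
    have habcd := hact ![WithLp.toLp 2 a, WithLp.toLp 2 b, WithLp.toLp 2 c, WithLp.toLp 2 d]
    rw [h, three_mul_cay_apply] at habcd
    exact habcd.symm
  · rintro ⟨R, hR⟩
    refine AlternatingMap.ext fun v => mul_left_cancel₀ (three_ne_zero (α := ℝ)) ?_
    rw [hact, three_mul_cay_apply, altSum_transpose_mulVec hg hR]

/-! ### The spin representation -/

/-- Complexification of real matrices. -/
def complexify : Matrix (Fin 8) (Fin 8) ℝ →ₐ[ℝ] Matrix (Fin 8) (Fin 8) ℂ :=
  Complex.ofRealAm.mapMatrix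

theorem complexify_injective : Function.Injective complexify :=
  Matrix.map_injective Complex.ofReal_injective

theorem complexify_transpose (A : Matrix (Fin 8) (Fin 8) ℝ) :
    complexify Aᵀ = (complexify A)ᵀ := rfl

theorem det_complexify (A : Matrix (Fin 8) (Fin 8) ℝ) : (complexify A).det = (A.det : ℂ) :=
  (RingHom.map_det Complex.ofRealHom A).symm

/-- The complex spin representation of the Clifford algebra of `ℝ⁷`. -/
def spinRep : CliffordAlgebra Q7 →ₐ[ℝ] Matrix (Fin 8) (Fin 8) ℂ :=
  CliffordAlgebra.lift Q7 ⟨Complex.I • (complexify.toLinearMap ∘ₗ gam), fun v => by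
    simp only [LinearMap.smul_apply, LinearMap.comp_apply, AlgHom.toLinearMap_apply,
      smul_mul_smul_comm, Complex.I_mul_I, ← map_mul, gam_mul_self, neg_smul, one_smul,
      Q7_apply, Algebra.algebraMap_eq_smul_one]
    rw [map_neg, neg_neg, map_smul, map_one]⟩

theorem spinRep_ι (v : Fin 7 → ℝ) :
    spinRep (CliffordAlgebra.ι Q7 v) = Complex.I • complexify (gam v) :=
  CliffordAlgebra.lift_ι_apply _ _ _

/-- The real spin representation of the even Clifford algebra of `ℝ⁷`. -/
def evenSpinRep : CliffordAlgebra.even Q7 →ₐ[ℝ] Matrix (Fin 8) (Fin 8) ℝ :=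
  CliffordAlgebra.even.lift Q7
    { bilin := -(LinearMap.mul ℝ (Matrix (Fin 8) (Fin 8) ℝ)).compl₁₂ gam gam
      contract := fun v => by
        simp [gam_mul_self, Q7_apply, Algebra.algebraMap_eq_smul_one]
      contract_mid := fun u v w => by
        simp only [LinearMap.neg_apply, LinearMap.compl₁₂_apply, LinearMap.mul_apply', neg_mul_neg]
        rw [mul_assoc, ← mul_assoc (gam v), gam_mul_self, smul_mul_assoc, one_mul, mul_smul_comm,
          neg_smul, smul_neg, Q7_apply] }

theorem complexify_evenSpinRep (a : CliffordAlgebra.even Q7) :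
    complexify (evenSpinRep a) = spinRep a := by
  have h : complexify.comp evenSpinRep = spinRep.comp (CliffordAlgebra.even Q7).val := by
    apply CliffordAlgebra.even.algHom_ext
    ext1
    refine LinearMap.ext₂ fun v w => ?_
    change complexify (evenSpinRep ((CliffordAlgebra.even.ι Q7).bilin v w)) =
      spinRep (CliffordAlgebra.ι Q7 v * CliffordAlgebra.ι Q7 w)
    rw [evenSpinRep, CliffordAlgebra.even.lift_ι, map_mul, spinRep_ι, spinRep_ι,
      smul_mul_smul_comm, Complex.I_mul_I, neg_one_smul]
    simp
  exact AlgHom.congr_fun h a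

theorem spinRep_star (a : CliffordAlgebra Q7) : spinRep (star a) = (spinRep a)ᵀ := by
  induction a using CliffordAlgebra.induction with
  | algebraMap r =>
    rw [CliffordAlgebra.star_algebraMap, AlgHom.commutes, Algebra.algebraMap_eq_smul_one,
      Matrix.transpose_smul, Matrix.transpose_one]
  | ι v =>
    rw [CliffordAlgebra.star_ι, map_neg, spinRep_ι, Matrix.transpose_smul,
      ← complexify_transpose, gam_transpose, map_neg, smul_neg]
  | mul a b ha hb => rw [star_mul, map_mul, map_mul, ha, hb, Matrix.transpose_mul]
  | add a b ha hb => rw [star_add, map_add, map_add, ha, hb, Matrix.transpose_add]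

theorem I_smul_one_mem_range_spinRep :
    (Complex.I • 1 : Matrix (Fin 8) (Fin 8) ℂ) ∈ spinRep.range := by
  have hprod : ∀ l : List (Fin 7),
      Complex.I ^ l.length • complexify (l.map Jreal).prod ∈ spinRep.range := by
    intro l
    induction l with
    | nil => simp [one_mem]
    | cons i l ih =>
      rw [List.length_cons, List.map_cons, List.prod_cons, map_mul, pow_succ',
        ← smul_mul_smul_comm]
      exact mul_mem ⟨_, (spinRep_ι (Pi.single i 1)).trans (by rw [gam_single])⟩ ih
  have h := hprod (List.finRange 7)
  rw [← List.ofFn_eq_map, Jreal_prod, map_one, List.length_finRange] at h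
  have hI : Complex.I ^ 7 = -Complex.I := by
    rw [show (7 : ℕ) = 2 * 3 + 1 from rfl, pow_succ, pow_mul, Complex.I_sq]
    ring
  rw [hI, neg_smul] at h
  exact neg_mem_iff.1 h

theorem spinRep_surjective : Function.Surjective spinRep := by
  have hI := I_smul_one_mem_range_spinRep
  have hreal (A : Matrix (Fin 8) (Fin 8) ℝ) : complexify A ∈ spinRep.range := by
    have hle : Algebra.adjoin ℝ (Set.range Jreal) ≤ spinRep.range.comap complexify := by
      rw [Algebra.adjoin_le_iff]
      rintro _ ⟨i, rfl⟩
      have h := mul_mem hI (⟨_, (spinRep_ι (Pi.single i 1)).trans (by rw [gam_single])⟩ :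
        Complex.I • complexify (Jreal i) ∈ spinRep.range)
      rw [smul_mul_smul_comm, Complex.I_mul_I, one_mul, neg_one_smul] at h
      change complexify (Jreal i) ∈ spinRep.range
      exact neg_mem_iff.1 h
    exact hle (adjoin_range_Jreal ▸ Algebra.mem_top)
  intro M
  have hM : M = complexify (M.map Complex.re) +
      (Complex.I • 1) * complexify (M.map Complex.im) := by
    ext i j
    rw [smul_mul_assoc, one_mul]
    simp only [complexify, AlgHom.mapMatrix_apply, Matrix.add_apply, Matrix.map_apply,
      Matrix.smul_apply, Complex.ofRealAm_coe, smul_eq_mul]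
    rw [mul_comm, Complex.re_add_im]
  have hmem : M ∈ spinRep.range := hM ▸ add_mem (hreal _) (mul_mem hI (hreal _))
  exact hmem

theorem spinRep_injective : Function.Injective spinRep := by
  obtain ⟨hfin, hle⟩ := finite_cliffordAlgebra_and_finrank_le Q7
  have hdim : Module.finrank ℝ (Matrix (Fin 8) (Fin 8) ℂ) = 2 ^ 7 := by
    rw [Module.finrank_matrix, Complex.finrank_real_complex, Fintype.card_fin]
    norm_num
  rw [Module.finrank_fin_fun] at hle
  have heq : Module.finrank ℝ (CliffordAlgebra Q7) =
      Module.finrank ℝ (Matrix (Fin 8) (Fin 8) ℂ) :=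
    le_antisymm (hdim ▸ hle)
      (LinearMap.finrank_le_finrank_of_surjective (f := spinRep.toLinearMap) spinRep_surjective)
  exact (LinearMap.injective_iff_surjective_of_finrank_eq_finrank
    (f := spinRep.toLinearMap) heq).2 spinRep_surjective

theorem evenSpinRep_injective : Function.Injective evenSpinRep := by
  intro a b h
  apply Subtype.ext
  apply spinRep_injective
  rw [← complexify_evenSpinRep, ← complexify_evenSpinRep, h]

theorem det_gam_ne_zero {v : Fin 7 → ℝ} (hv : v ≠ 0) : (gam v).det ≠ 0 := by
  intro h
  have h2 := congrArg Matrix.det (gam_mul_self v)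
  rw [Matrix.det_mul, h, zero_mul, Matrix.det_smul, Matrix.det_one, mul_one, eq_comm] at h2
  exact hv (dotProduct_self_eq_zero.1 (neg_eq_zero.1 ((pow_eq_zero_iff (by simp)).1 h2)))

theorem det_gam_eq_of_dotProduct_eq {v w : Fin 7 → ℝ} (h : v ⬝ᵥ v = w ⬝ᵥ w) :
    (gam v).det = (gam w).det := by
  by_cases hvw : v + w = 0
  · rw [eq_neg_of_add_eq_zero_left hvw, map_neg, Matrix.det_neg, Fintype.card_fin]
    norm_num
  · have hcomm : gam (v + w) * gam v = gam w * gam (v + w) := by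
      rw [map_add, add_mul, mul_add, gam_mul_self, gam_mul_self, h, add_comm]
    have hdet := congrArg Matrix.det hcomm
    rw [Matrix.det_mul, Matrix.det_mul, mul_comm] at hdet
    exact mul_right_cancel₀ (det_gam_ne_zero hvw) hdet

theorem det_Jreal (i : Fin 7) : (Jreal i).det = 1 := by
  have heq (j : Fin 7) : (Jreal j).det = (Jreal i).det := by
    rw [← gam_single, ← gam_single]
    exact det_gam_eq_of_dotProduct_eq (by simp)
  have h := congrArg Matrix.detMonoidHom Jreal_prod
  rw [map_list_prod, List.map_ofFn, map_one, List.prod_ofFn] at h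
  simp only [Function.comp_apply, Matrix.coe_detMonoidHom, heq, Finset.prod_const,
    Finset.card_univ, Fintype.card_fin] at h
  have h2 := congrArg Matrix.det (Jreal_mul_self i)
  simp only [Matrix.det_mul, Matrix.det_neg, Matrix.det_one, Fintype.card_fin] at h2
  rw [Even.neg_one_pow (by decide), one_mul, mul_self_eq_one_iff] at h2
  rcases h2 with h2 | h2
  · exact h2
  · rw [h2] at h
    norm_num at h

theorem det_gam_pos {v : Fin 7 → ℝ} (hv : v ≠ 0) : 0 < (gam v).det := by
  have hpos : 0 < v ⬝ᵥ v :=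
    lt_of_le_of_ne (Finset.sum_nonneg fun i _ => mul_self_nonneg (v i))
      fun h => hv (dotProduct_self_eq_zero.1 h.symm)
  have h : (gam v).det = (gam (√(v ⬝ᵥ v) • Pi.single 0 1)).det :=
    det_gam_eq_of_dotProduct_eq (by simp [Real.mul_self_sqrt hpos.le])
  rw [h, map_smul, gam_single, Matrix.det_smul, det_Jreal, mul_one]
  positivity

theorem det_spinRep_pos {x : (CliffordAlgebra Q7)ˣ} (hx : x ∈ lipschitzGroup Q7) :
    ∃ r : ℝ, 0 < r ∧ (spinRep x).det = r := by
  unfold lipschitzGroup at hx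
  induction hx using Subgroup.closure_induction with
  | mem x hx =>
    obtain ⟨v, hv⟩ := hx
    have hv0 : v ≠ 0 := by
      rintro rfl
      rw [map_zero] at hv
      exact x.ne_zero hv.symm
    refine ⟨_, det_gam_pos hv0, ?_⟩
    have hI : Complex.I ^ 8 = 1 := by
      rw [show (8 : ℕ) = 4 * 2 from rfl, pow_mul, Complex.I_pow_four, one_pow]
    rw [← hv, spinRep_ι, Matrix.det_smul, det_complexify, Fintype.card_fin, hI, one_mul]
  | one => exact ⟨1, one_pos, by simp⟩
  | mul x y _ _ hx hy =>
    obtain ⟨r, hr, hxr⟩ := hx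
    obtain ⟨s, hs, hys⟩ := hy
    exact ⟨r * s, mul_pos hr hs, by rw [Units.val_mul, map_mul, Matrix.det_mul, hxr, hys]; simp⟩
  | inv x _ hx =>
    obtain ⟨r, hr, hxr⟩ := hx
    refine ⟨r⁻¹, inv_pos.2 hr, ?_⟩
    have h : (spinRep ↑x⁻¹).det * (spinRep x).det = 1 := by
      rw [← Matrix.det_mul, ← map_mul, Units.inv_mul, map_one, Matrix.det_one]
    rw [eq_inv_of_mul_eq_one_left h, hxr, Complex.ofReal_inv]

/-- The spin representation of `Spin(7)` on `ℝ⁸`. -/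
def spinGroupRep : spinGroup Q7 →* Matrix (Fin 8) (Fin 8) ℝ where
  toFun x := evenSpinRep ⟨x, x.2.2⟩
  map_one' := map_one evenSpinRep
  map_mul' x y := map_mul evenSpinRep ⟨x, x.2.2⟩ ⟨y, y.2.2⟩

theorem complexify_spinGroupRep (x : spinGroup Q7) :
    complexify (spinGroupRep x) = spinRep x :=
  complexify_evenSpinRep ⟨x, x.2.2⟩

theorem spinGroupRep_injective : Function.Injective spinGroupRep := by
  intro x y h
  have hxy : (⟨x, x.2.2⟩ : CliffordAlgebra.even Q7) = ⟨y, y.2.2⟩ := evenSpinRep_injective h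
  exact Subtype.ext (Subtype.mk.inj hxy)

theorem spinGroupRep_mul_transpose (x : spinGroup Q7) :
    spinGroupRep x * (spinGroupRep x)ᵀ = 1 := by
  apply complexify_injective
  rw [map_mul, complexify_transpose, complexify_spinGroupRep, ← spinRep_star, ← map_mul,
    spinGroup.mul_star_self_of_mem x.2, map_one, map_one]

theorem det_spinGroupRep (x : spinGroup Q7) : (spinGroupRep x).det = 1 := by
  obtain ⟨r, hr, hdet⟩ :=
    det_spinRep_pos (x := spinGroup.toUnits x) (spinGroup.units_mem_lipschitzGroup x.2)
  rw [spinGroup.val_toUnits_apply, ← complexify_spinGroupRep, det_complexify,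
    Complex.ofReal_inj] at hdet
  have h := congrArg Matrix.det (spinGroupRep_mul_transpose x)
  rw [Matrix.det_mul, Matrix.det_transpose, Matrix.det_one] at h
  nlinarith [mul_self_eq_one_iff.1 h]

theorem exists_spinGroupRep_conj_gam (x : spinGroup Q7) :
    ∃ R : Matrix (Fin 7) (Fin 7) ℝ,
      ∀ v, spinGroupRep x * gam v * (spinGroupRep x)ᵀ = gam (R *ᵥ v) := by
  refine exists_conj_gam_of_forall_Jreal fun k => ?_
  obtain ⟨w, hw⟩ := spinGroup.conjAct_smul_ι_mem_range_ι (x := spinGroup.toUnits x) x.2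
    (Pi.single k 1)
  rw [ConjAct.units_smul_def, ConjAct.ofConjAct_toConjAct] at hw
  change _ = (x : CliffordAlgebra Q7) * _ * star (x : CliffordAlgebra Q7) at hw
  refine ⟨w, complexify_injective (smul_right_injective _ Complex.I_ne_zero ?_)⟩
  have h := congrArg spinRep hw
  rw [map_mul, map_mul, spinRep_star, spinRep_ι, spinRep_ι, gam_single,
    ← complexify_spinGroupRep, ← complexify_transpose, mul_smul_comm, smul_mul_assoc] at h
  simpa only [map_mul] using h.symm

/-! ### Lifting orthogonal transformations to the Clifford algebra -/

theorem ι_mul_ι_add_swap_eq (v w : Fin 7 → ℝ) :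
    CliffordAlgebra.ι Q7 v * CliffordAlgebra.ι Q7 w +
      CliffordAlgebra.ι Q7 w * CliffordAlgebra.ι Q7 v = (2 * (v ⬝ᵥ w)) • 1 := by
  rw [CliffordAlgebra.ι_mul_ι_add_swap, QuadraticMap.polar, Q7_apply, Q7_apply, Q7_apply,
    Algebra.algebraMap_eq_smul_one, add_dotProduct, dotProduct_add, dotProduct_add,
    dotProduct_comm w v]
  congr 1
  ring

theorem ι_mul_self_of_norm_eq_one {u : EuclideanSpace ℝ (Fin 7)} (hu : ‖u‖ = 1) :
    CliffordAlgebra.ι Q7 u.ofLp * CliffordAlgebra.ι Q7 u.ofLp = 1 := by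
  have h : u.ofLp ⬝ᵥ u.ofLp = 1 := by
    have h2 := real_inner_self_eq_norm_sq u
    rwa [hu, one_pow, EuclideanSpace.inner_eq_star_dotProduct] at h2
  rw [CliffordAlgebra.ι_sq_scalar, Q7_apply, h, map_one]

theorem ι_mul_ι_eq_neg_reflection {u : EuclideanSpace ℝ (Fin 7)} (hu : ‖u‖ = 1)
    (x : EuclideanSpace ℝ (Fin 7)) :
    CliffordAlgebra.ι Q7 u.ofLp * CliffordAlgebra.ι Q7 x.ofLp =
      -(CliffordAlgebra.ι Q7 ((ℝ ∙ u)ᗮ.reflection x).ofLp * CliffordAlgebra.ι Q7 u.ofLp) := by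
  have hs : ((ℝ ∙ u)ᗮ.reflection x).ofLp = x.ofLp - (2 * (u.ofLp ⬝ᵥ x.ofLp)) • u.ofLp := by
    rw [Submodule.reflection_orthogonal_apply, Submodule.reflection_singleton_apply, hu,
      EuclideanSpace.inner_eq_star_dotProduct, neg_sub, dotProduct_comm]
    simp [two_mul, add_smul, two_smul]
  rw [hs, map_sub, map_smul, sub_mul, smul_mul_assoc, ι_mul_self_of_norm_eq_one hu,
    ← ι_mul_ι_add_swap_eq]
  abel

/-- A product of reflections lifts to a homogeneous element of the Lipschitz group. -/
theorem exists_lift_list_prod_reflection (l : List (EuclideanSpace ℝ (Fin 7))) :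
    ∃ (y : (CliffordAlgebra Q7)ˣ) (k : ℕ), y ∈ lipschitzGroup Q7 ∧
      (y : CliffordAlgebra Q7) ∈ CliffordAlgebra.evenOdd Q7 (k : ZMod 2) ∧
      star (y : CliffordAlgebra Q7) * y = (-1 : ℝ) ^ k • 1 ∧
      ∀ x : EuclideanSpace ℝ (Fin 7), y * CliffordAlgebra.ι Q7 x.ofLp = (-1 : ℝ) ^ k •
        (CliffordAlgebra.ι Q7 ((l.map fun v => (ℝ ∙ v)ᗮ.reflection).prod x).ofLp * y) := by
  induction l with
  | nil =>
    refine ⟨1, 0, one_mem _, ?_, by simp, by simp⟩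
    rw [Nat.cast_zero]
    exact one_mem (CliffordAlgebra.even Q7)
  | cons v l ih =>
    obtain ⟨y, k, hy, hyk, hstar, hconj⟩ := ih
    by_cases hv : v = 0
    · refine ⟨y, k, hy, hyk, hstar, fun x => ?_⟩
      rw [hconj, List.map_cons, List.prod_cons, hv, LinearIsometryEquiv.coe_mul,
        Function.comp_apply, Submodule.reflection_orthogonal_apply,
        Submodule.reflection_singleton_apply, smul_zero, smul_zero, zero_sub, neg_neg]
    · obtain ⟨u, hu, hspan⟩ : ∃ u : EuclideanSpace ℝ (Fin 7), ‖u‖ = 1 ∧ (ℝ ∙ v) = ℝ ∙ u :=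
        ⟨‖v‖⁻¹ • v, norm_smul_inv_norm (𝕜 := ℝ) hv, (Submodule.span_singleton_smul_eq
          (IsUnit.mk0 _ (inv_ne_zero (norm_ne_zero_iff.2 hv))) v).symm⟩
      have hu2 := ι_mul_self_of_norm_eq_one hu
      refine ⟨⟨_, _, hu2, hu2⟩ * y, k + 1, mul_mem (Subgroup.subset_closure ⟨_, rfl⟩) hy,
        ?_, ?_, fun x => ?_⟩
      · rw [Nat.cast_add, Nat.cast_one, add_comm]
        exact SetLike.GradedMul.mul_mem (CliffordAlgebra.ι_mem_evenOdd_one Q7 _) hyk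
      · rw [Units.val_mul, star_mul, CliffordAlgebra.star_ι, mul_assoc, ← mul_assoc (-_),
          neg_mul, hu2, neg_one_mul, mul_neg, hstar, pow_succ, mul_neg_one, neg_smul]
      · simp only [Units.val_mul, List.map_cons, List.prod_cons]
        rw [mul_assoc, hconj, mul_smul_comm, ← mul_assoc, ι_mul_ι_eq_neg_reflection hu,
          LinearIsometryEquiv.coe_mul, Function.comp_apply]
        simp only [hspan]
        rw [neg_mul, mul_assoc, pow_succ, mul_neg_one, neg_smul, smul_neg]

theorem exists_lift_of_transpose_mul_self {R : Matrix (Fin 7) (Fin 7) ℝ} (hR : Rᵀ * R = 1) :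
    ∃ (y : (CliffordAlgebra Q7)ˣ) (k : ℕ), y ∈ lipschitzGroup Q7 ∧
      (y : CliffordAlgebra Q7) ∈ CliffordAlgebra.evenOdd Q7 (k : ZMod 2) ∧
      star (y : CliffordAlgebra Q7) * y = (-1 : ℝ) ^ k • 1 ∧
      ∀ v : Fin 7 → ℝ, y * CliffordAlgebra.ι Q7 v =
        (-1 : ℝ) ^ k • (CliffordAlgebra.ι Q7 (R *ᵥ v) * y) := by
  let φ : EuclideanSpace ℝ (Fin 7) ≃ₗᵢ[ℝ] EuclideanSpace ℝ (Fin 7) :=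
    ((Matrix.toEuclideanLin R).isometryOfInner fun v w => by
      rw [EuclideanSpace.inner_eq_star_dotProduct, EuclideanSpace.inner_eq_star_dotProduct,
        star_trivial, star_trivial, Matrix.ofLp_toLpLin, Matrix.ofLp_toLpLin,
        Matrix.toLin'_apply, Matrix.toLin'_apply, Matrix.dotProduct_mulVec, Matrix.vecMul_mulVec, hR,
        Matrix.vecMul_one]).toLinearIsometryEquiv rfl
  obtain ⟨l, -, hl⟩ := φ.reflections_generate_dim
  obtain ⟨y, k, hy, hyk, hstar, hconj⟩ := exists_lift_list_prod_reflection l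
  refine ⟨y, k, hy, hyk, hstar, fun v => ?_⟩
  have h := hconj (WithLp.toLp 2 v)
  rwa [← hl] at h

theorem neg_one_mem_spinGroup : (-1 : CliffordAlgebra Q7) ∈ spinGroup Q7 := by
  have hu : ‖(EuclideanSpace.single 0 1 : EuclideanSpace ℝ (Fin 7))‖ = 1 := by simp
  have hsq := ι_mul_self_of_norm_eq_one hu
  set a := CliffordAlgebra.ι Q7 (EuclideanSpace.single (0 : Fin 7) (1 : ℝ)).ofLp
  let p : (CliffordAlgebra Q7)ˣ := ⟨a, a, hsq, hsq⟩
  have hp : p ∈ lipschitzGroup Q7 := Subgroup.subset_closure ⟨_, rfl⟩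
  have hn : -p ∈ lipschitzGroup Q7 :=
    Subgroup.subset_closure ⟨-(EuclideanSpace.single (0 : Fin 7) (1 : ℝ)).ofLp, map_neg _ _⟩
  have hprod : ((p * -p : (CliffordAlgebra Q7)ˣ) : CliffordAlgebra Q7) = -1 := by
    rw [Units.val_mul, Units.val_neg, mul_neg, hsq]
  refine ⟨⟨⟨p * -p, mul_mem hp hn, hprod⟩, ?_⟩,
    (CliffordAlgebra.even Q7).neg_mem (one_mem _)⟩
  rw [SetLike.mem_coe, Unitary.mem_iff]
  simp

/-- A matrix anticommuting with the seven complexified generators vanishes. -/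
theorem eq_zero_of_anticommute_complexify_Jreal {B : Matrix (Fin 8) (Fin 8) ℂ}
    (h : ∀ i, B * complexify (Jreal i) = -(complexify (Jreal i) * B)) : B = 0 := by
  have hlist : ∀ l : List (Fin 7), B * complexify (l.map Jreal).prod =
      (-1) ^ l.length * (complexify (l.map Jreal).prod * B) := by
    intro l
    induction l with
    | nil => simp
    | cons i l ih =>
      rw [List.map_cons, List.prod_cons, map_mul, ← mul_assoc, h, neg_mul, mul_assoc, ih,
        List.length_cons, pow_succ', ← mul_assoc (complexify (Jreal i)),
        ((Commute.neg_one_right (complexify (Jreal i))).pow_right _).eq]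
      noncomm_ring
  have h7 := hlist (List.finRange 7)
  rw [← List.ofFn_eq_map, Jreal_prod, map_one, List.length_finRange, mul_one, one_mul,
    Odd.neg_one_pow (by decide), neg_one_mul] at h7
  ext i j
  exact self_eq_neg.1 (congrFun (congrFun h7 i) j)

theorem mem_range_spinGroupRep {g : Matrix (Fin 8) (Fin 8) ℝ} (hg : g * gᵀ = 1)
    {R : Matrix (Fin 7) (Fin 7) ℝ} (hR : ∀ v, g * gam v * gᵀ = gam (R *ᵥ v)) :
    g ∈ Set.range spinGroupRep := by
  have hg' : gᵀ * g = 1 := mul_eq_one_comm.1 hg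
  obtain ⟨y, k, hy, hyk, hstar, hconj⟩ :=
    exists_lift_of_transpose_mul_self (transpose_mul_self_of_conj_gam hg hR)
  have hgR (v : Fin 7 → ℝ) : gᵀ * gam (R *ᵥ v) = gam v * gᵀ := by
    rw [← hR, mul_assoc g, ← mul_assoc, hg', one_mul]
  have hrep (v : Fin 7 → ℝ) : spinRep y * complexify (gam v) =
      (-1 : ℝ) ^ k • (complexify (gam (R *ᵥ v)) * spinRep y) := by
    have h := congrArg spinRep (hconj v)
    rw [map_mul, map_smul, map_mul, spinRep_ι, spinRep_ι, mul_smul_comm, smul_mul_assoc,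
      smul_comm] at h
    exact smul_right_injective _ Complex.I_ne_zero h
  have hB (v : Fin 7 → ℝ) : complexify gᵀ * spinRep y * complexify (gam v) =
      (-1 : ℝ) ^ k • (complexify (gam v) * (complexify gᵀ * spinRep y)) := by
    rw [mul_assoc, hrep, mul_smul_comm, ← mul_assoc, ← map_mul, hgR, map_mul, mul_assoc]
  rcases Nat.even_or_odd k with hk | hk
  · rw [ZMod.natCast_eq_zero_iff_even.2 hk] at hyk
    rw [hk.neg_one_pow, one_smul] at hstar
    simp only [hk.neg_one_pow, one_smul] at hB
    have hstar' : (y : CliffordAlgebra Q7) * star (y : CliffordAlgebra Q7) = 1 := by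
      rw [← y.inv_eq_of_mul_eq_one_left hstar, Units.mul_inv]
    let x : spinGroup Q7 := ⟨y, pinGroup.units_mem_iff.2 ⟨hy, Unitary.mem_iff.2 ⟨hstar, hstar'⟩⟩,
      hyk⟩
    have hcomm (i : Fin 7) : Jreal i * (gᵀ * spinGroupRep x) = gᵀ * spinGroupRep x * Jreal i := by
      apply complexify_injective
      have h := hB (Pi.single i 1)
      rw [gam_single] at h
      simp only [map_mul, complexify_spinGroupRep]
      exact h.symm
    obtain ⟨c, hc⟩ := exists_eq_smul_one_of_commute_Jreal hcomm
    have hx : spinGroupRep x = c • g := by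
      rw [← one_mul (spinGroupRep x), ← hg, mul_assoc, hc, mul_smul_comm, mul_one]
    have hc2 : c * c = 1 := by
      have h := spinGroupRep_mul_transpose x
      rw [hx, Matrix.transpose_smul, smul_mul_smul_comm, hg] at h
      simpa using congrFun (congrFun h 0) 0
    rcases mul_self_eq_one_iff.1 hc2 with rfl | rfl
    · exact ⟨x, by rw [hx, one_smul]⟩
    · refine ⟨⟨-1, neg_one_mem_spinGroup⟩ * x, ?_⟩
      have hneg : spinGroupRep ⟨-1, neg_one_mem_spinGroup⟩ = -1 := by
        apply complexify_injective
        rw [complexify_spinGroupRep, map_neg, map_neg, map_one, map_one]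
      rw [map_mul, hneg, hx, neg_one_mul, neg_one_smul, neg_neg]
  · simp only [hk.neg_one_pow, neg_one_smul] at hB
    have hzero := eq_zero_of_anticommute_complexify_Jreal fun i => by
      simpa only [gam_single] using hB (Pi.single i 1)
    have hy0 : spinRep y = 0 := by
      rw [← one_mul (spinRep y), ← map_one complexify, ← hg, map_mul, mul_assoc, hzero, mul_zero]
    have h1 := congrArg spinRep y.mul_inv
    rw [map_mul, hy0, zero_mul, map_one] at h1
    exact absurd h1 zero_ne_one

/-- The stabilizer of the Cayley form in `SO(8)` is isomorphic as a group to `Spin(7)`,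
the spin group of the standard quadratic form on `ℝ⁷` realized inside its Clifford algebra:
there is an injective (monoid) homomorphism from `Spin(7)` to the `8 × 8` matrices whose
range is exactly the stabilizer `{g ∈ SO(8) : g·cay = cay}`. -/
theorem stabilizer_cayley_iso_spin7 :
    ∃ φ : (spinGroup Q7) →* Matrix (Fin 8) (Fin 8) ℝ,
      Function.Injective φ ∧
      Set.range φ = {g : Matrix (Fin 8) (Fin 8) ℝ | IsSO8 g ∧ formAct g cay = cay} := by
  refine ⟨spinGroupRep, spinGroupRep_injective, Set.ext fun g => ⟨?_, ?_⟩⟩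
  · rintro ⟨x, rfl⟩
    have hx := spinGroupRep_mul_transpose x
    exact ⟨⟨hx, det_spinGroupRep x⟩,
      (formAct_cay_eq_iff hx).2 (exists_spinGroupRep_conj_gam x)⟩
  · rintro ⟨⟨hg, -⟩, hcay⟩
    obtain ⟨R, hR⟩ := (formAct_cay_eq_iff hg).1 hcay
    exact mem_range_spinGroupRep hg hR
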